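/- Let Ω ⊆ ℝⁿ be open, p ≥ 2 a real number, and u : Ω → ℝ a continuously differentiable function satisfying ∫_Ω ‖∇u‖^{p−2} ⟨∇u, ∇η⟩ dx = 0 for every Lipschitz function η : Ω → ℝ with compact support in Ω (where ∇η is the a.e. gradient). Then for every x₀ ∈ Ω, all radii 0 < r < R with the closed ball B̄(x₀, R) ⊆ Ω, and every c ∈ ℝ: (∫_{B(x₀, r)} ‖∇u‖^p dx)^{1/p} ≤ (p/(R − r)) · (∫_{B(x₀, R)} |u − c|^p dx)^{1/p}. -/

import Mathlib

open scoped RealInnerProductSpace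
open MeasureTheory Metric

/-- The product of a bounded Lipschitz function vanishing outside `s` with a function that is
bounded and Lipschitz on `s` is Lipschitz. -/
lemma LipschitzWith.exists_lipschitzWith_mul {X : Type*} [PseudoMetricSpace X] {s : Set X}
    {f g : X → ℝ} {K L M : NNReal} (hf : LipschitzWith K f) (hf_one : ∀ x, |f x| ≤ 1)
    (hf_zero : ∀ x ∉ s, f x = 0) (hg : LipschitzOnWith L g s) (hgM : ∀ x ∈ s, |g x| ≤ M) :
    ∃ C, LipschitzWith C (fun x => f x * g x) := by
  have aux : ∀ x, ∀ y ∈ s, |f x * g x - f y * g y| ≤ (L + K * M) * dist x y := by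
    intro x y hy
    have h1 : |f x - f y| * |g y| ≤ K * dist x y * M :=
      mul_le_mul (hf.dist_le_mul x y) (hgM y hy) (abs_nonneg _) (by positivity)
    by_cases hx : x ∈ s
    · have h2 : |f x| * |g x - g y| ≤ 1 * (L * dist x y) :=
        mul_le_mul (hf_one x) (hg.dist_le_mul x hx y hy) (abs_nonneg _) zero_le_one
      calc |f x * g x - f y * g y| = |f x * (g x - g y) + (f x - f y) * g y| := by ring_nf
        _ ≤ |f x * (g x - g y)| + |(f x - f y) * g y| := abs_add_le _ _
        _ ≤ _ := by rw [abs_mul, abs_mul]; linarith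
    · rw [hf_zero x hx] at h1 ⊢
      have h2 : 0 ≤ L * dist x y := by positivity
      rw [← abs_mul] at h1
      calc |0 * g x - f y * g y| = |(0 - f y) * g y| := by ring_nf
        _ ≤ _ := by linarith
  refine ⟨L + K * M, LipschitzWith.of_dist_le_mul fun x y => ?_⟩
  rw [Real.dist_eq]
  push_cast
  by_cases hy : y ∈ s
  · exact aux x y hy
  by_cases hx : x ∈ s
  · rw [abs_sub_comm, dist_comm]
    exact aux y x hx
  · simp only [hf_zero x hx, hf_zero y hy, zero_mul, sub_zero, abs_zero]
    positivity

/-- A power `p ≥ 1` of a Lipschitz function with values in `[0, 1]` is Lipschitz. -/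
lemma LipschitzWith.exists_lipschitzWith_rpow {X : Type*} [PseudoMetricSpace X]
    {f : X → ℝ} {K : NNReal} (hf : LipschitzWith K f) (hf_mem : ∀ x, f x ∈ Set.Icc (0 : ℝ) 1)
    {p : ℝ} (hp : 1 ≤ p) : ∃ C, LipschitzWith C (fun x => f x ^ p) := by
  have h : ContDiff ℝ (1 : ℕ) (fun t : ℝ => t ^ p) :=
    Real.contDiff_rpow_const_of_le (by simpa using hp)
  obtain ⟨L, hL⟩ := h.contDiffOn.exists_lipschitzOnWith (by simp) (convex_Icc (0 : ℝ) 1)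
    isCompact_Icc
  refine ⟨L * K, ?_⟩
  rw [← lipschitzOnWith_univ]
  exact hL.comp hf.lipschitzOnWith fun x _ => hf_mem x

/-- The cutoff function equal to `1` on `ball x₀ r`, to `0` outside `ball x₀ R`, and affine in the
distance to `x₀` in between. -/
noncomputable def ballCutoff {X : Type*} [PseudoMetricSpace X] (x₀ : X) (r R : ℝ) (x : X) : ℝ :=
  min 1 (max 0 ((R - dist x x₀) / (R - r)))

section ballCutoff

variable {X : Type*} [PseudoMetricSpace X] {x₀ x : X} {r R : ℝ}

lemma ballCutoff_mem_Icc : ballCutoff x₀ r R x ∈ Set.Icc (0 : ℝ) 1 :=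
  ⟨le_min zero_le_one (le_max_left _ _), min_le_left _ _⟩

lemma ballCutoff_eq_one (hrR : r < R) (hx : x ∈ ball x₀ r) : ballCutoff x₀ r R x = 1 := by
  refine min_eq_left (le_max_of_le_right ?_)
  rw [le_div_iff₀ (sub_pos.2 hrR)]
  linarith [mem_ball.1 hx]

lemma ballCutoff_eq_zero (hrR : r < R) (hx : x ∉ ball x₀ R) : ballCutoff x₀ r R x = 0 := by
  rw [mem_ball, not_lt] at hx
  rw [ballCutoff, max_eq_left (div_nonpos_of_nonpos_of_nonneg (by linarith) (by linarith)),
    min_eq_right zero_le_one]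

lemma lipschitzWith_ballCutoff (hrR : r < R) :
    LipschitzWith (Real.toNNReal (R - r)⁻¹) (ballCutoff x₀ r R) := by
  have hpos : 0 < R - r := sub_pos.2 hrR
  have h : LipschitzWith (Real.toNNReal (R - r)⁻¹) fun y : X => (R - dist y x₀) / (R - r) := by
    refine LipschitzWith.of_dist_le_mul fun y z => ?_
    rw [Real.coe_toNNReal _ (inv_nonneg.2 hpos.le), Real.dist_eq, ← sub_div, abs_div,
      abs_of_pos hpos, div_eq_inv_mul]
    refine mul_le_mul_of_nonneg_left ?_ (inv_nonneg.2 hpos.le)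
    rw [sub_sub_sub_cancel_left, abs_sub_comm]
    exact abs_dist_sub_le y z x₀
  exact (h.const_max 0).const_min 1

end ballCutoff

/-- If `F` has zero integral and differs from `a ^ p` by at most `k * a ^ (p - 1) * b`, then
Hölder's inequality bounds the `L^p` norm of `a` by `k` times that of `b`. -/
lemma rpow_integral_le_of_abs_sub_le {α : Type*} [MeasurableSpace α] {μ : Measure α}
    [IsFiniteMeasure μ] {p k A B : ℝ} (hp : 1 < p) (hk : 0 ≤ k) {a b F : α → ℝ}
    (ha : AEStronglyMeasurable a μ) (hb : AEStronglyMeasurable b μ)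
    (hF : AEStronglyMeasurable F μ) (ha_nonneg : ∀ x, 0 ≤ a x) (hb_nonneg : ∀ x, 0 ≤ b x)
    (haA : ∀ᵐ x ∂μ, a x ≤ A) (hbB : ∀ᵐ x ∂μ, b x ≤ B) (hF_zero : ∫ x, F x ∂μ = 0)
    (h : ∀ᵐ x ∂μ, |F x - a x ^ p| ≤ k * (a x ^ (p - 1) * b x)) :
    (∫ x, a x ^ p ∂μ) ^ (1 / p) ≤ k * (∫ x, b x ^ p ∂μ) ^ (1 / p) := by
  have hp0 : 0 < p := by linarith
  have hpq : (p / (p - 1)).HolderConjugate p := (Real.HolderConjugate.conjExponent hp).symm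
  have hap : AEStronglyMeasurable (fun x => a x ^ p) μ :=
    (ha.aemeasurable.pow_const p).aestronglyMeasurable
  have haq : AEStronglyMeasurable (fun x => a x ^ (p - 1)) μ :=
    (ha.aemeasurable.pow_const (p - 1)).aestronglyMeasurable
  have hap_int : Integrable (fun x => a x ^ p) μ := by
    refine Integrable.of_bound hap (A ^ p) ?_
    filter_upwards [haA] with x hx
    rw [Real.norm_of_nonneg (Real.rpow_nonneg (ha_nonneg x) _)]
    exact Real.rpow_le_rpow (ha_nonneg x) hx hp0.le
  have haq_bound : ∀ᵐ x ∂μ, ‖a x ^ (p - 1)‖ ≤ A ^ (p - 1) := by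
    filter_upwards [haA] with x hx
    rw [Real.norm_of_nonneg (Real.rpow_nonneg (ha_nonneg x) _)]
    exact Real.rpow_le_rpow (ha_nonneg x) hx (by linarith)
  have hb_bound : ∀ᵐ x ∂μ, ‖b x‖ ≤ B := by
    filter_upwards [hbB] with x hx
    rwa [Real.norm_of_nonneg (hb_nonneg x)]
  have hab_int : Integrable (fun x => a x ^ (p - 1) * b x) μ :=
    (Integrable.of_bound hb B hb_bound).bdd_mul haq haq_bound
  have hF_int : Integrable F μ := by
    have h_diff : Integrable (fun x => F x - a x ^ p) μ :=
      (hab_int.const_mul k).mono' (hF.sub hap) h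
    exact (h_diff.add hap_int).congr (Filter.Eventually.of_forall fun x => sub_add_cancel _ _)
  have hmain : ∫ x, a x ^ p ∂μ ≤ k * ∫ x, a x ^ (p - 1) * b x ∂μ := by
    have h_le : ∫ x, a x ^ p ∂μ ≤ ∫ x, (F x + k * (a x ^ (p - 1) * b x)) ∂μ := by
      refine integral_mono_ae hap_int (hF_int.add (hab_int.const_mul k)) ?_
      filter_upwards [h] with x hx
      linarith [neg_le_of_abs_le hx]
    rwa [integral_add hF_int (hab_int.const_mul k), hF_zero, zero_add,
      integral_const_mul] at h_le
  have hholder := integral_mul_le_Lp_mul_Lq_of_nonneg (μ := μ) hpq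
    (Filter.Eventually.of_forall fun x => Real.rpow_nonneg (ha_nonneg x) (p - 1))
    (Filter.Eventually.of_forall hb_nonneg)
    (MemLp.of_bound haq _ haq_bound) (MemLp.of_bound hb _ hb_bound)
  have hpow : ∀ x, (a x ^ (p - 1)) ^ (p / (p - 1)) = a x ^ p := fun x => by
    rw [← Real.rpow_mul (ha_nonneg x), mul_div_cancel₀ _ (by linarith : p - 1 ≠ 0)]
  simp only [hpow] at hholder
  have hI : 0 ≤ ∫ x, a x ^ p ∂μ := integral_nonneg fun x => Real.rpow_nonneg (ha_nonneg x) _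
  have hJ : 0 ≤ ∫ x, b x ^ p ∂μ := integral_nonneg fun x => Real.rpow_nonneg (hb_nonneg x) _
  generalize (∫ x, a x ^ p ∂μ) = I at *
  generalize (∫ x, b x ^ p ∂μ) = J at *
  rcases hI.eq_or_lt with rfl | hI
  · rw [Real.zero_rpow (by positivity)]
    positivity
  have hle := hmain.trans (mul_le_mul_of_nonneg_left hholder hk)
  have hsplit : I = I ^ (1 / (p / (p - 1))) * I ^ (1 / p) := by
    rw [← Real.rpow_add hI]
    have : 1 / (p / (p - 1)) + 1 / p = 1 := by field_simp; ring
    rw [this, Real.rpow_one]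
  refine le_of_mul_le_mul_left ?_ (Real.rpow_pos_of_pos hI (1 / (p / (p - 1))))
  rw [← hsplit]
  linarith

section Gradient

variable {E : Type*} [NormedAddCommGroup E] [InnerProductSpace ℝ E] [CompleteSpace E]

lemma measurable_gradient [MeasurableSpace E] [BorelSpace E] (f : E → ℝ) :
    Measurable (gradient f) :=
  (InnerProductSpace.toDual ℝ E).symm.continuous.measurable.comp (measurable_fderiv ℝ f)

lemma ContDiffOn.continuousOn_gradient {f : E → ℝ} {s : Set E} (hf : ContDiffOn ℝ 1 f s)
    (hs : IsOpen s) : ContinuousOn (gradient f) s :=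
  (InnerProductSpace.toDual ℝ E).symm.continuous.comp_continuousOn
    (hf.continuousOn_fderiv_of_isOpen hs le_rfl)

/-- Pointwise estimate for the `p`-Laplacian integrand tested against `φ ^ p * (u - c)`. -/
lemma abs_inner_gradient_rpow_mul_sub_le {u φ : E → ℝ} {x : E} {p c : ℝ} {K : NNReal}
    (hp : 2 ≤ p) (hu : DifferentiableAt ℝ u x) (hφ : DifferentiableAt ℝ φ x)
    (hφ_nonneg : 0 ≤ φ x) (hφK : LipschitzWith K φ) :
    |‖gradient u x‖ ^ (p - 2) *
          ⟪gradient u x, gradient (fun y => φ y ^ p * (u y - c)) x⟫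
        - (φ x * ‖gradient u x‖) ^ p| ≤
      p * K * ((φ x * ‖gradient u x‖) ^ (p - 1) * |u x - c|) := by
  set g := gradient u x with hg
  have hη : fderiv ℝ (fun y => φ y ^ p * (u y - c)) x =
      (φ x ^ p) • fderiv ℝ u x + (u x - c) • (p * φ x ^ (p - 1)) • fderiv ℝ φ x :=
    ((hφ.hasFDerivAt.rpow_const (Or.inr (by linarith))).mul
      (hu.hasFDerivAt.sub_const c)).fderiv
  have hug : fderiv ℝ u x g = ‖g‖ ^ 2 := by
    rw [← inner_gradient_left, ← hg, real_inner_self_eq_norm_sq]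
  have hφg : |fderiv ℝ φ x g| ≤ K * ‖g‖ :=
    (fderiv ℝ φ x).le_of_opNorm_le (norm_fderiv_le_of_lipschitz ℝ hφK) g
  have hpow_one : ‖g‖ ^ (p - 2) * ‖g‖ = ‖g‖ ^ (p - 1) := by
    rw [← Real.rpow_add_one' (norm_nonneg _) (by linarith)]
    ring_nf
  have hpow_two : ‖g‖ ^ (p - 2) * ‖g‖ ^ 2 = ‖g‖ ^ p := by
    rw [← Real.rpow_add_natCast' (norm_nonneg _) (by push_cast; linarith)]
    norm_num
  have hdiff : ‖g‖ ^ (p - 2) * ⟪g, gradient (fun y => φ y ^ p * (u y - c)) x⟫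
      - (φ x * ‖g‖) ^ p =
      ‖g‖ ^ (p - 2) * ((u x - c) * (p * φ x ^ (p - 1)) * fderiv ℝ φ x g) := by
    rw [inner_gradient_right, hη, Real.mul_rpow hφ_nonneg (norm_nonneg _), ← hpow_two]
    simp [hug]
    ring
  rw [hdiff, abs_mul, abs_mul, abs_mul, abs_mul, Real.mul_rpow hφ_nonneg (norm_nonneg _),
    ← hpow_one, abs_of_nonneg (Real.rpow_nonneg (norm_nonneg g) _),
    abs_of_nonneg (Real.rpow_nonneg hφ_nonneg _), abs_of_nonneg (by linarith : 0 ≤ p)]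
  calc ‖g‖ ^ (p - 2) * (|u x - c| * (p * φ x ^ (p - 1)) * |fderiv ℝ φ x g|)
      ≤ ‖g‖ ^ (p - 2) * (|u x - c| * (p * φ x ^ (p - 1)) * (K * ‖g‖)) := by
        gcongr
    _ = _ := by ring

end Gradient

/-- Caccioppoli inequality on balls (Corollary 5.3 for the classical Dirichlet form on `ℝⁿ`):
if `u` is `C¹` on the open set `Ω` and `∫_Ω ‖∇u‖^(p-2)⟨∇u, ∇η⟩ = 0` for every Lipschitz
test function `η` with compact support in `Ω` (with `∇η` its a.e. gradient), then for every
`x₀ ∈ Ω`, radii `0 < r < R` with the closed ball `B̄(x₀, R) ⊆ Ω`, and every `c ∈ ℝ`,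
`(∫_{B(x₀,r)} ‖∇u‖^p)^(1/p) ≤ (p/(R-r)) (∫_{B(x₀,R)} |u - c|^p)^(1/p)`. -/
theorem stmt17 {n : ℕ} (Ω : Set (EuclideanSpace ℝ (Fin n))) (hΩ : IsOpen Ω)
    (p : ℝ) (hp : 2 ≤ p)
    (u : EuclideanSpace ℝ (Fin n) → ℝ) (hu : ContDiffOn ℝ 1 u Ω)
    (huharm : ∀ η : EuclideanSpace ℝ (Fin n) → ℝ,
      (∃ L : NNReal, LipschitzWith L η) → HasCompactSupport η → tsupport η ⊆ Ω →
      ∫ x in Ω, ‖gradient u x‖ ^ (p - 2) * ⟪gradient u x, gradient η x⟫ = 0)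
    (x₀ : EuclideanSpace ℝ (Fin n)) (hx₀ : x₀ ∈ Ω) (r R : ℝ) (hr : 0 < r) (hrR : r < R)
    (hball : closedBall x₀ R ⊆ Ω) (c : ℝ) :
    (∫ x in ball x₀ r, ‖gradient u x‖ ^ p) ^ (1 / p) ≤
      (p / (R - r)) * (∫ x in ball x₀ R, |u x - c| ^ p) ^ (1 / p) := by
  set φ := ballCutoff x₀ r R with hφ
  have hφ_mem : ∀ x, φ x ∈ Set.Icc (0 : ℝ) 1 := fun x => ballCutoff_mem_Icc
  have hφ_lip : LipschitzWith (Real.toNNReal (R - r)⁻¹) φ := lipschitzWith_ballCutoff hrR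
  have hφ_zero : ∀ x ∉ ball x₀ R, φ x = 0 := fun x hx => ballCutoff_eq_zero hrR hx
  have hp0 : 0 < p := by linarith
  have hRr : 0 < R - r := sub_pos.2 hrR
  have hsub : ball x₀ R ⊆ Ω := ball_subset_closedBall.trans hball
  have hcompact : IsCompact (closedBall x₀ R) := isCompact_closedBall x₀ R
  have hv_cont : ContinuousOn (fun x => u x - c) (closedBall x₀ R) :=
    (hu.continuousOn.mono hball).sub continuousOn_const
  obtain ⟨A, hA⟩ :=
    hcompact.exists_bound_of_continuousOn ((hu.continuousOn_gradient hΩ).mono hball)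
  obtain ⟨M, hM⟩ := hcompact.exists_bound_of_continuousOn hv_cont
  set η : EuclideanSpace ℝ (Fin n) → ℝ := fun y => φ y ^ p * (u y - c) with hη
  have hη_zero : ∀ x ∉ ball x₀ R, η x = 0 := fun x hx => by
    simp [hη, hφ_zero x hx, Real.zero_rpow hp0.ne']
  have hη_lip : ∃ L : NNReal, LipschitzWith L η := by
    obtain ⟨K, hK⟩ := hφ_lip.exists_lipschitzWith_rpow hφ_mem (by linarith : 1 ≤ p)
    obtain ⟨L, hL⟩ := ((hu.mono hball).sub contDiffOn_const).exists_lipschitzOnWith one_ne_zero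
      (convex_closedBall x₀ R) hcompact
    refine hK.exists_lipschitzWith_mul (s := ball x₀ R) (M := M.toNNReal) (fun x => ?_)
      (fun x hx => ?_) (hL.mono ball_subset_closedBall) fun x hx => ?_
    · rw [abs_of_nonneg (Real.rpow_nonneg (hφ_mem x).1 _)]
      exact Real.rpow_le_one (hφ_mem x).1 (hφ_mem x).2 hp0.le
    · rw [hφ_zero x hx, Real.zero_rpow hp0.ne']
    · exact (hM x (ball_subset_closedBall hx)).trans (Real.le_coe_toNNReal M)
  have hη_supp : Function.support η ⊆ closedBall x₀ R := fun x hx => by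
    by_contra hx'
    exact hx (hη_zero x fun h => hx' (ball_subset_closedBall h))
  have hη_tsupp : tsupport η ⊆ closedBall x₀ R := closure_minimal hη_supp isClosed_closedBall
  have hweak := huharm η hη_lip (hcompact.of_isClosed_subset (isClosed_tsupport η) hη_tsupp)
    (hη_tsupp.trans hball)
  set F : EuclideanSpace ℝ (Fin n) → ℝ := fun x =>
    ‖gradient u x‖ ^ (p - 2) * ⟪gradient u x, gradient η x⟫ with hF
  have hest : ∀ᵐ x, x ∈ Ω → |F x - (φ x * ‖gradient u x‖) ^ p| ≤
      p / (R - r) * ((φ x * ‖gradient u x‖) ^ (p - 1) * |u x - c|) := by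
    filter_upwards [hφ_lip.ae_differentiableAt (μ := volume)] with x hx hxΩ
    have := abs_inner_gradient_rpow_mul_sub_le (c := c) hp
      ((hu.differentiableOn one_ne_zero).differentiableAt (hΩ.mem_nhds hxΩ)) hx (hφ_mem x).1 hφ_lip
    rwa [Real.coe_toNNReal _ (inv_nonneg.2 hRr.le), ← div_eq_mul_inv] at this
  have hF_zero : ∫ x in ball x₀ R, F x = 0 := by
    rw [← hweak]
    refine (setIntegral_eq_of_subset_of_ae_sdiff_eq_zero hΩ.measurableSet.nullMeasurableSet hsub
      ?_).symm
    filter_upwards [hest] with x hx hxΩ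
    have := hx hxΩ.1
    rw [hφ_zero x hxΩ.2, zero_mul, Real.zero_rpow hp0.ne', Real.zero_rpow (by linarith)] at this
    simpa using this
  have hF_meas : Measurable F :=
    ((measurable_gradient u).norm.pow_const _).mul
      ((measurable_gradient u).inner (measurable_gradient η))
  have ha_meas : Measurable fun x => φ x * ‖gradient u x‖ :=
    hφ_lip.continuous.measurable.mul (measurable_gradient u).norm
  have ha_nonneg : ∀ x, 0 ≤ φ x * ‖gradient u x‖ := fun x =>
    mul_nonneg (hφ_mem x).1 (norm_nonneg _)
  have ha_le : ∀ x ∈ ball x₀ R, φ x * ‖gradient u x‖ ≤ A := fun x hx =>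
    (mul_le_of_le_one_left (norm_nonneg _) (hφ_mem x).2).trans
      (hA x (ball_subset_closedBall hx))
  have : IsFiniteMeasure (volume.restrict (ball x₀ R)) :=
    isFiniteMeasure_restrict.2 measure_ball_lt_top.ne
  have hkey := rpow_integral_le_of_abs_sub_le (μ := volume.restrict (ball x₀ R))
    (by linarith : 1 < p) (div_nonneg hp0.le hRr.le) ha_meas.aestronglyMeasurable
    ((hv_cont.mono ball_subset_closedBall).abs.aestronglyMeasurable measurableSet_ball)
    hF_meas.aestronglyMeasurable ha_nonneg (fun x => abs_nonneg (u x - c))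
    (ae_restrict_of_forall_mem measurableSet_ball ha_le)
    (ae_restrict_of_forall_mem measurableSet_ball fun x hx => hM x (ball_subset_closedBall hx))
    hF_zero ((ae_restrict_iff' measurableSet_ball).2 (hest.mono fun x hx h => hx (hsub h)))
  refine le_trans (Real.rpow_le_rpow
    (integral_nonneg fun x => Real.rpow_nonneg (norm_nonneg _) _) ?_ (by positivity)) hkey
  have hmono : ∫ x in ball x₀ r, (φ x * ‖gradient u x‖) ^ p ≤
      ∫ x in ball x₀ R, (φ x * ‖gradient u x‖) ^ p := by
    refine setIntegral_mono_set ?_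
      (Filter.Eventually.of_forall fun x => Real.rpow_nonneg (ha_nonneg x) p)
      (ball_subset_ball hrR.le).eventuallyLE
    refine Integrable.of_bound (ha_meas.pow_const p).aestronglyMeasurable (A ^ p)
      (ae_restrict_of_forall_mem measurableSet_ball fun x hx => ?_)
    rw [Real.norm_of_nonneg (Real.rpow_nonneg (ha_nonneg x) _)]
    exact Real.rpow_le_rpow (ha_nonneg x) (ha_le x hx) hp0.le
  refine le_trans (le_of_eq (setIntegral_congr_fun measurableSet_ball fun x hx => ?_)) hmono
  simp only [hφ, ballCutoff_eq_one hrR hx, one_mul]
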